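/- Let K̂ be a bounded open subset of ℝ² and F : K̂ → K an injective map onto an open set K, twice differentiable on K̂ with differentiable inverse, whose Jacobian determinant J(x̂) = det DF(x̂) is strictly positive for every x̂ ∈ K̂. Let τ̂ : K̂ → M₂(ℝ) be a continuously differentiable 2×2 matrix field whose row-wise divergence div τ̂ is continuous and square-integrable on K̂. If ∫_K div(P¹τ̂)(x) · (div τ̂)(F⁻¹(x)) dx = 0, then div τ̂ ≡ 0 on K̂ and div(P¹τ̂) ≡ 0 on K. -/

import Mathlib

open MeasureTheory

/-- The Jacobian determinant of a map `F : ℝ² → ℝ²` at a point. -/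
noncomputable def jacDet (F : ℝ × ℝ → ℝ × ℝ) (x : ℝ × ℝ) : ℝ :=
  LinearMap.det ((fderiv ℝ F x).toLinearMap)

/-- The divergence of a planar vector field: `div v = ∂₁ v₁ + ∂₂ v₂`. -/
noncomputable def vdiv (v : ℝ × ℝ → ℝ × ℝ) (x : ℝ × ℝ) : ℝ :=
  ((fderiv ℝ v x) (1, 0)).1 + ((fderiv ℝ v x) (0, 1)).2

/-- The Piola transform of a vector field `v̂` on `K̂`, as a vector field on `K`:
`(P¹ v̂)(F x̂) = J(x̂)⁻¹ • DF(x̂) v̂(x̂)`, expressed via the inverse map `G` of `F`. -/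
noncomputable def piola (F G : ℝ × ℝ → ℝ × ℝ) (v : ℝ × ℝ → ℝ × ℝ) (x : ℝ × ℝ) : ℝ × ℝ :=
  (jacDet F (G x))⁻¹ • (fderiv ℝ F (G x)) (v (G x))

/-- The `i`-th row of a `2×2` matrix field, as a planar vector field. -/
def rowv (τ : ℝ × ℝ → Matrix (Fin 2) (Fin 2) ℝ) (i : Fin 2) (x : ℝ × ℝ) : ℝ × ℝ :=
  (τ x i 0, τ x i 1)

/-- The row-wise divergence of a `2×2` matrix field. -/
noncomputable def matDiv (τ : ℝ × ℝ → Matrix (Fin 2) (Fin 2) ℝ) (x : ℝ × ℝ) : ℝ × ℝ :=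
  (vdiv (rowv τ 0) x, vdiv (rowv τ 1) x)

/-- The row-by-row Piola transform of a `2×2` matrix field. -/
noncomputable def piolaMat (F G : ℝ × ℝ → ℝ × ℝ) (τ : ℝ × ℝ → Matrix (Fin 2) (Fin 2) ℝ)
    (x : ℝ × ℝ) : Matrix (Fin 2) (Fin 2) ℝ :=
  Matrix.of ![![(piola F G (rowv τ 0) x).1, (piola F G (rowv τ 0) x).2],
              ![(piola F G (rowv τ 1) x).1, (piola F G (rowv τ 1) x).2]]

/-- The Euclidean dot product on `ℝ²`. -/
def dotp (a b : ℝ × ℝ) : ℝ := a.1 * b.1 + a.2 * b.2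

/-- The determinant of an endomorphism of `ℝ × ℝ` in coordinates. -/
lemma det_prod_eq (A : ℝ × ℝ →ₗ[ℝ] ℝ × ℝ) :
    LinearMap.det A = (A (1, 0)).1 * (A (0, 1)).2 - (A (0, 1)).1 * (A (1, 0)).2 := by
  rw [← LinearMap.det_toMatrix (Module.Basis.finTwoProd ℝ), Matrix.det_fin_two]
  simp [LinearMap.toMatrix_apply]

lemma jacDet_eq (F : ℝ × ℝ → ℝ × ℝ) (x : ℝ × ℝ) :
    jacDet F x = (fderiv ℝ F x (1, 0)).1 * (fderiv ℝ F x (0, 1)).2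
      - (fderiv ℝ F x (0, 1)).1 * (fderiv ℝ F x (1, 0)).2 :=
  det_prod_eq _

lemma clm_prod_apply {M : Type*} [AddCommGroup M] [Module ℝ M] [TopologicalSpace M]
    (A : ℝ × ℝ →L[ℝ] M) (h : ℝ × ℝ) :
    A h = h.1 • A (1, 0) + h.2 • A (0, 1) := by
  rw [← map_smul, ← map_smul, ← map_add]
  simp

/-- Cramer's rule in `ℝ × ℝ`. -/
lemma eq_of_clm_prod_apply_eq (A : ℝ × ℝ →L[ℝ] ℝ × ℝ) {J : ℝ}
    (hJ : J = (A (1, 0)).1 * (A (0, 1)).2 - (A (0, 1)).1 * (A (1, 0)).2) (hJ0 : J ≠ 0)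
    {g h : ℝ × ℝ} (hg : A g = h) :
    g = J⁻¹ • ((A (0, 1)).2 * h.1 - (A (0, 1)).1 * h.2,
      (A (1, 0)).1 * h.2 - (A (1, 0)).2 * h.1) := by
  rw [eq_inv_smul_iff₀ hJ0, ← hg, clm_prod_apply A g, hJ]
  ext <;> simp <;> ring

/-- The derivative of the Jacobian determinant of a twice differentiable map. -/
lemma hasFDerivAt_jacDet {F : ℝ × ℝ → ℝ × ℝ} {x : ℝ × ℝ}
    (hF2 : DifferentiableAt ℝ (fderiv ℝ F) x) :
    ∃ L : ℝ × ℝ →L[ℝ] ℝ, HasFDerivAt (jacDet F) L x ∧ ∀ h, L h =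
      (fderiv ℝ (fderiv ℝ F) x h (1, 0)).1 * (fderiv ℝ F x (0, 1)).2
      + (fderiv ℝ F x (1, 0)).1 * (fderiv ℝ (fderiv ℝ F) x h (0, 1)).2
      - (fderiv ℝ (fderiv ℝ F) x h (0, 1)).1 * (fderiv ℝ F x (1, 0)).2
      - (fderiv ℝ F x (0, 1)).1 * (fderiv ℝ (fderiv ℝ F) x h (1, 0)).2 := by
  have hcol (e : ℝ × ℝ) := hF2.hasFDerivAt.clm_apply (hasFDerivAt_const e x)
  rw [show jacDet F = _ from funext (jacDet_eq F)]
  refine ⟨_, ((hcol (1, 0)).fst.mul (hcol (0, 1)).snd).sub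
    ((hcol (0, 1)).fst.mul (hcol (1, 0)).snd), fun h => ?_⟩
  simp
  ring

/-- The Piola transform divides the divergence by the Jacobian determinant. -/
lemma vdiv_piola {F G v : ℝ × ℝ → ℝ × ℝ} {x : ℝ × ℝ}
    (hF : ∀ᶠ y in nhds x, DifferentiableAt ℝ F y)
    (hF2 : DifferentiableAt ℝ (fderiv ℝ F) x)
    (hG : DifferentiableAt ℝ G (F x)) (hGF : G (F x) = x)
    (hFG : ∀ᶠ y in nhds (F x), F (G y) = y)
    (hJ : jacDet F x ≠ 0) (hv : DifferentiableAt ℝ v x) :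
    vdiv (piola F G v) (F x) = (jacDet F x)⁻¹ * vdiv v x := by
  have hsymm (u w : ℝ × ℝ) :
      fderiv ℝ (fderiv ℝ F) x u w = fderiv ℝ (fderiv ℝ F) x w u :=
    second_derivative_symmetric_of_eventually (hF.mono fun _ hy => hy.hasFDerivAt)
      hF2.hasFDerivAt u w
  have hinv (h : ℝ × ℝ) : fderiv ℝ F x (fderiv ℝ G (F x) h) = h := by
    have hFx : HasFDerivAt F (fderiv ℝ F x) (G (F x)) := by
      rw [hGF]; exact hF.self_of_nhds.hasFDerivAt
    have hid : HasFDerivAt (F ∘ G) (ContinuousLinearMap.id ℝ (ℝ × ℝ)) (F x) :=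
      (hasFDerivAt_id (F x)).congr_of_eventuallyEq hFG
    exact congrArg (fun A : ℝ × ℝ →L[ℝ] ℝ × ℝ => A h)
      ((hFx.comp (F x) hG.hasFDerivAt).unique hid)
  obtain ⟨L, hL, hLeq⟩ := hasFDerivAt_jacDet hF2
  have hw := ((hasFDerivAt_inv hJ).comp x hL).smul
    (hF2.hasFDerivAt.clm_apply hv.hasFDerivAt)
  rw [← hGF] at hw
  have hp := (hw.comp (F x) hG.hasFDerivAt).fderiv
  rw [hGF] at hp
  have hp' : fderiv ℝ (piola F G v) (F x) = _ := hp
  unfold vdiv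
  rw [hp']
  simp only [ContinuousLinearMap.comp_apply, add_apply,
    smul_apply, ContinuousLinearMap.smulRight_apply,
    ContinuousLinearMap.flip_apply, Function.comp_apply, hLeq]
  have hg₁ : fderiv ℝ G (F x) (1, 0) = (jacDet F x)⁻¹ •
      ((fderiv ℝ F x (0, 1)).2, -(fderiv ℝ F x (1, 0)).2) := by
    simpa using eq_of_clm_prod_apply_eq _ (jacDet_eq F x) hJ (hinv (1, 0))
  have hg₂ : fderiv ℝ G (F x) (0, 1) = (jacDet F x)⁻¹ •
      (-(fderiv ℝ F x (0, 1)).1, (fderiv ℝ F x (1, 0)).1) := by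
    simpa using eq_of_clm_prod_apply_eq _ (jacDet_eq F x) hJ (hinv (0, 1))
  have hJeq := jacDet_eq F x
  have hs := hsymm (1, 0) (0, 1)
  rw [hg₁, hg₂]
  generalize jacDet F x = J at *
  generalize fderiv ℝ (fderiv ℝ F) x = B at *
  generalize fderiv ℝ F x = A at *
  generalize fderiv ℝ v x = V at *
  generalize v x = w at *
  simp only [map_smul, smul_apply, ContinuousLinearMap.toSpanSingleton_apply]
  rw [clm_prod_apply V (_, -_), clm_prod_apply V (-_, _), clm_prod_apply B (_, -_),
    clm_prod_apply B (-_, _)]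
  simp only [smul_eq_mul, map_add, map_smul, add_apply, smul_apply]
  rw [clm_prod_apply (B (1, 0)) w, clm_prod_apply (B (0, 1)) w, clm_prod_apply A w,
    clm_prod_apply A (V (1, 0)), clm_prod_apply A (V (0, 1)), ← hs]
  simp only [Prod.fst_add, Prod.snd_add, Prod.smul_fst, Prod.smul_snd, smul_eq_mul]
  generalize A (1, 0) = a at *
  generalize A (0, 1) = b at *
  generalize B (1, 0) (1, 0) = p at *
  generalize B (1, 0) (0, 1) = q at *
  generalize B (0, 1) (0, 1) = r at *
  field_simp
  rw [hJeq]
  ring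

lemma matDiv_piolaMat {F G : ℝ × ℝ → ℝ × ℝ} {τ : ℝ × ℝ → Matrix (Fin 2) (Fin 2) ℝ}
    {x : ℝ × ℝ} (hF : ∀ᶠ y in nhds x, DifferentiableAt ℝ F y)
    (hF2 : DifferentiableAt ℝ (fderiv ℝ F) x)
    (hG : DifferentiableAt ℝ G (F x)) (hGF : G (F x) = x)
    (hFG : ∀ᶠ y in nhds (F x), F (G y) = y)
    (hJ : jacDet F x ≠ 0) (hτ : ∀ i, DifferentiableAt ℝ (rowv τ i) x) :
    matDiv (piolaMat F G τ) (F x) = (jacDet F x)⁻¹ • matDiv τ x := by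
  have hrow (i : Fin 2) : rowv (piolaMat F G τ) i = piola F G (rowv τ i) := by
    fin_cases i <;> rfl
  simp only [matDiv, hrow, vdiv_piola hF hF2 hG hGF hFG hJ (hτ _), Prod.smul_mk, smul_eq_mul]

lemma dotp_smul_left (c : ℝ) (a b : ℝ × ℝ) : dotp (c • a) b = c * dotp a b := by
  simp [dotp]
  ring

lemma dotp_self_nonneg (a : ℝ × ℝ) : 0 ≤ dotp a a :=
  add_nonneg (mul_self_nonneg _) (mul_self_nonneg _)

lemma dotp_self_eq_zero {a : ℝ × ℝ} : dotp a a = 0 ↔ a = 0 := by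
  rw [dotp, mul_self_add_mul_self_eq_zero, Prod.ext_iff]
  rfl

lemma dotp_self_le (a : ℝ × ℝ) : dotp a a ≤ 2 * ‖a‖ ^ 2 := by
  have h1 := sq_le_sq' (abs_le.1 (norm_fst_le a)).1 (abs_le.1 (norm_fst_le a)).2
  have h2 := sq_le_sq' (abs_le.1 (norm_snd_le a)).1 (abs_le.1 (norm_snd_le a)).2
  unfold dotp
  linarith

/-- Elementwise core of the paper's Theorem 2 (condition (S1)): if the divergence of the
Piola-transformed matrix field `τ̂` is `L²`-orthogonal over `K` to the transformed test
function `P⁰(div τ̂)`, then `div τ̂ ≡ 0` on `K̂` and `div (P¹ τ̂) ≡ 0` on `K`. -/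
theorem stmt_6
    (Khat K : Set (ℝ × ℝ)) (hKhat : IsOpen Khat) (hKb : Bornology.IsBounded Khat)
    (hK : IsOpen K)
    (F G : ℝ × ℝ → ℝ × ℝ)
    (hFinj : Set.InjOn F Khat) (hFK : F '' Khat = K)
    (hdF : ∀ xhat ∈ Khat, DifferentiableAt ℝ F xhat)
    (hdF2 : ∀ xhat ∈ Khat, DifferentiableAt ℝ (fun y => fderiv ℝ F y) xhat)
    (hdG : ∀ x ∈ K, DifferentiableAt ℝ G x)
    (hGF : ∀ xhat ∈ Khat, G (F xhat) = xhat)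
    (hFG : ∀ x ∈ K, F (G x) = x)
    (hJpos : ∀ xhat ∈ Khat, 0 < jacDet F xhat)
    (τ : ℝ × ℝ → Matrix (Fin 2) (Fin 2) ℝ)
    (hτ : ∀ i : Fin 2, ContDiffOn ℝ 1 (rowv τ i) Khat)
    (hdivcont : ContinuousOn (matDiv τ) Khat)
    (hdivL2 : IntegrableOn (fun xhat => ‖matDiv τ xhat‖ ^ 2) Khat)
    (horth : ∫ x in K, dotp (matDiv (piolaMat F G τ) x) (matDiv τ (G x)) = 0) :
    (∀ xhat ∈ Khat, matDiv τ xhat = 0) ∧ (∀ x ∈ K, matDiv (piolaMat F G τ) x = 0) := by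
  have hpt (y) (hy : y ∈ Khat) :
      matDiv (piolaMat F G τ) (F y) = (jacDet F y)⁻¹ • matDiv τ y := by
    have hFy : F y ∈ K := hFK ▸ Set.mem_image_of_mem F hy
    exact matDiv_piolaMat (Filter.eventually_of_mem (hKhat.mem_nhds hy) hdF) (hdF2 y hy)
      (hdG _ hFy) (hGF y hy) (Filter.eventually_of_mem (hK.mem_nhds hFy) hFG) (hJpos y hy).ne'
      fun i => ((hτ i).contDiffAt (hKhat.mem_nhds hy)).differentiableAt one_ne_zero
  have hcont : ContinuousOn (fun y => dotp (matDiv τ y) (matDiv τ y)) Khat :=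
    (hdivcont.fst.mul hdivcont.fst).add (hdivcont.snd.mul hdivcont.snd)
  have hint : IntegrableOn (fun y => dotp (matDiv τ y) (matDiv τ y)) Khat := by
    refine (hdivL2.const_mul 2).mono' (hcont.aestronglyMeasurable hKhat.measurableSet)
      (Filter.Eventually.of_forall fun y => ?_)
    rw [Real.norm_of_nonneg (dotp_self_nonneg _)]
    exact dotp_self_le _
  have hzero : ∫ y in Khat, dotp (matDiv τ y) (matDiv τ y) = 0 := by
    rw [← horth, ← hFK, integral_image_eq_integral_abs_det_fderiv_smul volume
      hKhat.measurableSet (fun y hy => (hdF y hy).hasFDerivAt.hasFDerivWithinAt) hFinj]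
    refine setIntegral_congr_fun hKhat.measurableSet fun y hy => ?_
    change _ = |jacDet F y| • _
    simp only [hpt y hy, hGF y hy, dotp_smul_left]
    rw [abs_of_pos (hJpos y hy), smul_eq_mul, mul_inv_cancel_left₀ (hJpos y hy).ne']
  have hae := (setIntegral_eq_zero_iff_of_nonneg_ae
    (Filter.Eventually.of_forall fun y => dotp_self_nonneg (matDiv τ y)) hint).1 hzero
  have hdiv (y) (hy : y ∈ Khat) : matDiv τ y = 0 :=
    dotp_self_eq_zero.1 (Measure.eqOn_open_of_ae_eq hae hKhat hcont continuousOn_const hy)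
  refine ⟨hdiv, fun x hx => ?_⟩
  obtain ⟨y, hy, rfl⟩ := hFK ▸ hx
  rw [hpt y hy, hdiv y hy, smul_zero]
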